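/- The pure braid group PB(3) is isomorphic to ℤ × F₂, where F₂ is the free group on two generators; moreover the isomorphism can be chosen so that the ℤ factor corresponds to the subgroup of PB(3) generated by the full twist (β₁β₂)³. -/

import Mathlib

open FreeGroup

/-- Relations for the braid group `B(n)` on `n` strands: generators `β_i`, `i ∈ Fin (n-1)`
(0-indexed), with the Artin relations. -/
def braidRels (n : ℕ) : Set (FreeGroup (Fin (n - 1))) :=
  { r | (∃ i j : Fin (n - 1), ((i : ℕ) + 2 ≤ (j : ℕ) ∨ (j : ℕ) + 2 ≤ (i : ℕ)) ∧
          r = of i * of j * (of i)⁻¹ * (of j)⁻¹) ∨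
        (∃ i j : Fin (n - 1), (j : ℕ) = (i : ℕ) + 1 ∧
          r = of i * of j * of i * (of j * of i * of j)⁻¹) }

/-- The braid group `B(n)` as a presented group. -/
abbrev BraidGroup (n : ℕ) : Type := PresentedGroup (braidRels n)

/-- The `i`-th Artin generator `β_{i+1}` (0-indexed) of `B(n)`. -/
def bβ {n : ℕ} (i : Fin (n - 1)) : BraidGroup n := PresentedGroup.of i

/-- Relations for the ribbon braid group `RB(n)`: generators `β_i` (`Sum.inl`) and
`τ_j` (`Sum.inr`), 0-indexed. -/
def ribbonRels (n : ℕ) : Set (FreeGroup (Fin (n - 1) ⊕ Fin n)) :=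
  { r | (∃ i j : Fin (n - 1), ((i : ℕ) + 2 ≤ (j : ℕ) ∨ (j : ℕ) + 2 ≤ (i : ℕ)) ∧
          r = of (Sum.inl i) * of (Sum.inl j) * (of (Sum.inl i))⁻¹ * (of (Sum.inl j))⁻¹) ∨
        (∃ i j : Fin (n - 1), (j : ℕ) = (i : ℕ) + 1 ∧
          r = of (Sum.inl i) * of (Sum.inl j) * of (Sum.inl i) *
            (of (Sum.inl j) * of (Sum.inl i) * of (Sum.inl j))⁻¹) ∨
        (∃ (i : Fin (n - 1)) (j : Fin n), (j : ℕ) ≠ (i : ℕ) ∧ (j : ℕ) ≠ (i : ℕ) + 1 ∧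
          r = of (Sum.inl i) * of (Sum.inr j) * (of (Sum.inl i))⁻¹ * (of (Sum.inr j))⁻¹) ∨
        (∃ (i : Fin (n - 1)) (j k : Fin n), (j : ℕ) = (i : ℕ) + 1 ∧ (k : ℕ) = (i : ℕ) ∧
          r = of (Sum.inl i) * of (Sum.inr j) * (of (Sum.inr k) * of (Sum.inl i))⁻¹) ∨
        (∃ i j : Fin n, i ≠ j ∧
          r = of (Sum.inr i) * of (Sum.inr j) * (of (Sum.inr i))⁻¹ * (of (Sum.inr j))⁻¹) }

/-- The ribbon braid group `RB(n)` as a presented group. -/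
abbrev RibbonBraidGroup (n : ℕ) : Type := PresentedGroup (ribbonRels n)

/-- The generator `β_{i+1}` (0-indexed) of `RB(n)`. -/
def rβ {n : ℕ} (i : Fin (n - 1)) : RibbonBraidGroup n := PresentedGroup.of (Sum.inl i)

/-- The generator `τ_{j+1}` (0-indexed) of `RB(n)`. -/
def rτ {n : ℕ} (j : Fin n) : RibbonBraidGroup n := PresentedGroup.of (Sum.inr j)

/-- The inclusion `Fin (n-1) → Fin n` (`i ↦ i`). -/
def finL {n : ℕ} (i : Fin (n - 1)) : Fin n := ⟨(i : ℕ), by have := i.isLt; omega⟩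

/-- The shift `Fin (n-1) → Fin n` (`i ↦ i+1`). -/
def finR {n : ℕ} (i : Fin (n - 1)) : Fin n := ⟨(i : ℕ) + 1, by have := i.isLt; omega⟩

/-- The candidate model `ℤ × F₂` of the pure braid group on three strands. -/
abbrev PureModel : Type := Multiplicative ℤ × FreeGroup (Fin 2)

namespace PureModel

/-- The generator of the factor `ℤ`. -/
def z : PureModel := (Multiplicative.ofAdd 1, 1)

/-- The first free generator. -/
def x : PureModel := (1, of 0)

/-- The second free generator. -/
def y : PureModel := (1, of 1)

theorem z_mul_comm (h : PureModel) : z * h = h * z := by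
  ext1
  · exact mul_comm _ _
  · simp [z]

/-- The action of `β₁` on the six left cosets of the pure braid group represented by
`1, β₁, β₂, β₂β₁, β₁β₂, β₁β₂β₁`, together with the pure braids it produces. -/
def actOne : Equiv.Perm (Fin 6 × PureModel) :=
  Equiv.prodShear (Equiv.swap 0 1 * Equiv.swap 2 4 * Equiv.swap 3 5)
    fun i => Equiv.mulLeft ((![1, x, 1, 1, z * (y⁻¹ * x⁻¹), y] : Fin 6 → PureModel) i)

/-- The action of `β₂` on the same six left cosets. -/
def actTwo : Equiv.Perm (Fin 6 × PureModel) :=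
  Equiv.prodShear (Equiv.swap 0 2 * Equiv.swap 1 3 * Equiv.swap 4 5)
    fun i => Equiv.mulLeft ((![1, 1, y, z * (x⁻¹ * y⁻¹), 1, x] : Fin 6 → PureModel) i)

section

variable (h : PureModel)

theorem actOne_zero : actOne (0, h) = (1, h) := Prod.ext rfl (one_mul h)
theorem actOne_one : actOne (1, h) = (0, x * h) := Prod.ext rfl rfl
theorem actOne_two : actOne (2, h) = (4, h) := Prod.ext rfl (one_mul h)
theorem actOne_three : actOne (3, h) = (5, h) := Prod.ext rfl (one_mul h)
theorem actOne_four : actOne (4, h) = (2, z * (y⁻¹ * x⁻¹) * h) :=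
  Prod.ext rfl rfl
theorem actOne_five : actOne (5, h) = (3, y * h) := Prod.ext rfl rfl
theorem actTwo_zero : actTwo (0, h) = (2, h) := Prod.ext rfl (one_mul h)
theorem actTwo_one : actTwo (1, h) = (3, h) := Prod.ext rfl (one_mul h)
theorem actTwo_two : actTwo (2, h) = (0, y * h) := Prod.ext rfl rfl
theorem actTwo_three : actTwo (3, h) = (1, z * (x⁻¹ * y⁻¹) * h) :=
  Prod.ext rfl rfl
theorem actTwo_four : actTwo (4, h) = (5, h) := Prod.ext rfl (one_mul h)
theorem actTwo_five : actTwo (5, h) = (4, x * h) := Prod.ext rfl rfl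

end

theorem mul_z_mul (g h : PureModel) : g * (z * h) = z * (g * h) := by
  rw [← mul_assoc, ← z_mul_comm, mul_assoc]

theorem eq_top_of_generators_mem {K : Subgroup PureModel} (hz : z ∈ K) (hx : x ∈ K)
    (hy : y ∈ K) : K = ⊤ := by
  have hl (w : FreeGroup (Fin 2)) : (1, w) ∈ K := by
    change w ∈ K.comap (MonoidHom.inr _ _)
    induction w using FreeGroup.induction_on with
    | C1 => exact one_mem _
    | of i =>
      fin_cases i
      exacts [hx, hy]
    | inv_of i hi => exact inv_mem hi
    | mul v w hv hw => exact mul_mem hv hw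
  refine (Subgroup.eq_top_iff' K).2 fun ⟨n, w⟩ => ?_
  have : ((n, w) : PureModel) = z ^ n.toAdd * (1, w) := by
    ext1
    · simp [z, ← ofAdd_zsmul]
    · simp [z]
  rw [this]
  exact mul_mem (zpow_mem hz _) (hl w)

theorem actOne_actTwo_braid : actOne * actTwo * actOne = actTwo * actOne * actTwo := by
  ext1 ⟨i, h⟩
  fin_cases i <;>
    simp [actOne_zero, actOne_one, actOne_two, actOne_three, actOne_four, actOne_five,
      actTwo_zero, actTwo_one, actTwo_two, actTwo_three, actTwo_four, actTwo_five,
      mul_assoc, mul_z_mul]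

end PureModel

namespace BraidGroup

open PureModel

theorem braid_relation :
    (bβ 0 * bβ 1 * bβ 0 : BraidGroup 3) = bβ 1 * bβ 0 * bβ 1 := by
  have := PresentedGroup.one_of_mem (rels := braidRels 3)
    (x := of 0 * of 1 * of 0 * (of 1 * of 0 * of 1)⁻¹) (Or.inr ⟨0, 1, rfl, rfl⟩)
  rw [_root_.map_mul, _root_.map_inv, mul_inv_eq_one] at this
  exact this

theorem lift_eq_one_of_mem_braidRels {G : Type*} [Group G] {a b : G}
    (hab : a * b * a = b * a * b) :
    ∀ r ∈ braidRels 3, FreeGroup.lift (![a, b] : Fin 2 → G) r = 1 := by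
  rintro r (⟨i, j, hij, rfl⟩ | ⟨i, j, hij, rfl⟩)
  · omega
  · obtain rfl : i = 0 := by ext; simp; omega
    obtain rfl : j = 1 := by ext; simp at hij ⊢; omega
    rw [_root_.map_mul, _root_.map_inv, mul_inv_eq_one]
    simpa using hab

/-- The action of `B(3)` on cosets of the pure braid group, with values in `PureModel`. -/
def act : BraidGroup 3 →* Equiv.Perm (Fin 6 × PureModel) :=
  PresentedGroup.toGroup (lift_eq_one_of_mem_braidRels actOne_actTwo_braid)

theorem act_zero : act (bβ 0) = actOne :=
  PresentedGroup.toGroup.of (lift_eq_one_of_mem_braidRels actOne_actTwo_braid)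

theorem act_one : act (bβ 1) = actTwo :=
  PresentedGroup.toGroup.of (lift_eq_one_of_mem_braidRels actOne_actTwo_braid)

theorem induction₃ {p : BraidGroup 3 → Prop} (zero : p (bβ 0)) (one : p (bβ 1))
    (id : p 1) (mul : ∀ g h, p g → p h → p (g * h)) (inv : ∀ g, p g → p g⁻¹) (g) : p g := by
  have hg : g ∈ Subgroup.closure (Set.range (PresentedGroup.of (rels := braidRels 3))) := by
    rw [PresentedGroup.closure_range_of]; trivial
  induction hg using Subgroup.closure_induction with
  | mem _ h =>
    obtain ⟨i, rfl⟩ := h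
    change Fin 2 at i
    fin_cases i
    exacts [zero, one]
  | one => exact id
  | mul g h _ _ hg hh => exact mul g h hg hh
  | inv g _ hg => exact inv g hg

section CentralTwist

variable {G : Type*} [Group G] {a b : G}

theorem mul_pow_three_swap (h : a * b * a = b * a * b) : (a * b) ^ 3 = (b * a) ^ 3 := by
  calc (a * b) ^ 3 = (a * b * a) * (b * a * b) := by
        simp only [pow_succ, pow_zero, one_mul, mul_assoc]
    _ = (b * a * b) * (a * b * a) := by rw [h]
    _ = (b * a) ^ 3 := by simp only [pow_succ, pow_zero, one_mul, mul_assoc]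

theorem mul_pow_three_comm_left (h : a * b * a = b * a * b) :
    (a * b) ^ 3 * a = a * (a * b) ^ 3 := by
  conv_rhs => rw [mul_pow_three_swap h]
  simp only [pow_succ, pow_zero, one_mul, mul_assoc]

theorem mul_mul_eq_of_braid (h : a * b * a = b * a * b) :
    a * (a * b) = b * ((a * b) ^ 3 * ((b * b)⁻¹ * (a * a)⁻¹)) := by
  have h' (w : G) : a * (b * (a * w)) = b * (a * (b * w)) := by
    simpa only [mul_assoc] using congrArg (· * w) h
  have hb : (a * b) ^ 3 * b = b * (a * b) ^ 3 := by
    rw [mul_pow_three_swap h]; exact mul_pow_three_comm_left h.symm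
  rw [← mul_inv_rev, ← mul_assoc, ← mul_assoc, eq_mul_inv_iff_mul_eq, ← hb]
  simp only [pow_succ, pow_zero, one_mul, mul_assoc]
  rw [← h' (a * (b * b))]

end CentralTwist

/-- The full twist on three strands. -/
def fullTwist : BraidGroup 3 := (bβ 0 * bβ 1) ^ 3

theorem fullTwist_comm (g : BraidGroup 3) : Commute fullTwist g := by
  induction g using induction₃ with
  | zero => exact mul_pow_three_comm_left braid_relation
  | one =>
    unfold fullTwist
    rw [mul_pow_three_swap braid_relation]
    exact mul_pow_three_comm_left braid_relation.symm
  | id => exact .one_right _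
  | mul g h hg hh => exact hg.mul_right hh
  | inv g hg => exact hg.inv_right

/-- The embedding of `ℤ × F₂` onto the pure braid group. -/
def ofPure : PureModel →* BraidGroup 3 :=
  (zpowersHom _ fullTwist).noncommCoprod
    (FreeGroup.lift (![bβ 0 * bβ 0, bβ 1 * bβ 1] : Fin 2 → BraidGroup 3))
    fun n w => by
      rw [zpowersHom_apply]
      exact (fullTwist_comm _).zpow_left _

theorem ofPure_z : ofPure z = fullTwist := by simp [ofPure, z]

theorem ofPure_x : ofPure x = bβ 0 * bβ 0 := by simp [ofPure, x]

theorem ofPure_y : ofPure y = bβ 1 * bβ 1 := by simp [ofPure, y]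

/-- Representatives of the left cosets of the pure braid group. -/
def cosetRep : Fin 6 → BraidGroup 3 :=
  ![1, bβ 0, bβ 1, bβ 1 * bβ 0, bβ 0 * bβ 1, bβ 0 * bβ 1 * bβ 0]

/-- The decomposition of a braid into a coset representative and a pure braid. -/
def assemble (p : Fin 6 × PureModel) : BraidGroup 3 := cosetRep p.1 * ofPure p.2

theorem assemble_actOne (p : Fin 6 × PureModel) : assemble (actOne p) = bβ 0 * assemble p := by
  obtain ⟨i, h⟩ := p
  have h1 := mul_mul_eq_of_braid braid_relation
  have h2 : (bβ 1 * bβ 0 * (bβ 1 * bβ 1) : BraidGroup 3) = bβ 0 * (bβ 0 * bβ 1 * bβ 0) := by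
    rw [← mul_assoc, ← braid_relation, mul_assoc, mul_assoc, ← mul_assoc (bβ 1),
      ← braid_relation]
  fin_cases i <;>
    simp only [Fin.zero_eta, Fin.mk_one, Fin.reduceFinMk, actOne_zero, actOne_one, actOne_two,
      actOne_three, actOne_four, actOne_five, assemble, cosetRep, Matrix.cons_val] <;>
    simp only [ofPure.map_mul, ofPure.map_inv, ofPure_z, ofPure_x, ofPure_y, one_mul, ← mul_assoc,
      mul_left_inj]
  · simpa only [fullTwist, ← mul_assoc] using h1.symm
  · simpa only [← mul_assoc] using h2

theorem assemble_actTwo (p : Fin 6 × PureModel) : assemble (actTwo p) = bβ 1 * assemble p := by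
  obtain ⟨i, h⟩ := p
  have h1 := mul_mul_eq_of_braid braid_relation.symm
  rw [← mul_pow_three_swap braid_relation] at h1
  fin_cases i <;>
    simp only [Fin.zero_eta, Fin.mk_one, Fin.reduceFinMk, actTwo_zero, actTwo_one, actTwo_two,
      actTwo_three, actTwo_four, actTwo_five, assemble, cosetRep, Matrix.cons_val] <;>
    simp only [ofPure.map_mul, ofPure.map_inv, ofPure_z, ofPure_x, ofPure_y, one_mul, ← mul_assoc,
      mul_left_inj]
  · simpa only [fullTwist, ← mul_assoc] using h1.symm
  · exact braid_relation
  · exact braid_relation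

theorem assemble_act (g : BraidGroup 3) :
    ∀ p : Fin 6 × PureModel, assemble (act g p) = g * assemble p := by
  induction g using induction₃ with
  | zero => rw [act_zero]; exact assemble_actOne
  | one => rw [act_one]; exact assemble_actTwo
  | id => simp
  | mul g h hg hh => intro p; rw [_root_.map_mul, Equiv.Perm.mul_apply, hg, hh, mul_assoc]
  | inv g hg =>
    intro p
    rw [eq_inv_mul_iff_mul_eq, ← hg, _root_.map_inv, ← Equiv.Perm.mul_apply, mul_inv_cancel, Equiv.Perm.one_apply]

/-- The pairs of a braid and a pure braid that act alike on the base coset. -/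
def actGraph : Subgroup (BraidGroup 3 × PureModel) where
  carrier := {q | ∀ k, act q.1 (0, k) = (0, q.2 * k)}
  one_mem' k := by simp
  mul_mem' {q r} hq hr k := by
    simp only [Set.mem_ofPred_eq] at hq hr
    simp [hr, hq, mul_assoc]
  inv_mem' {q} hq k := by
    simp only [Set.mem_ofPred_eq] at hq
    rw [Prod.fst_inv, Prod.snd_inv, _root_.map_inv, Equiv.Perm.inv_eq_iff_eq, hq, mul_inv_cancel_left]

theorem act_ofPure (h k : PureModel) : act (ofPure h) (0, k) = (0, h * k) := by
  let f : PureModel →* BraidGroup 3 × PureModel := ofPure.prod (MonoidHom.id _)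
  have hz : z ∈ actGraph.comap f := fun k => by
    simp [f, ofPure_z, fullTwist, pow_succ, act_zero, act_one, actOne_one, actOne_two,
      actOne_five, actTwo_zero, actTwo_three, actTwo_four, mul_assoc, mul_z_mul]
  have hx : x ∈ actGraph.comap f := fun k => by
    simp [f, ofPure_x, act_zero, actOne_zero, actOne_one]
  have hy : y ∈ actGraph.comap f := fun k => by
    simp [f, ofPure_y, act_one, actTwo_zero, actTwo_two]
  have key : h ∈ actGraph.comap f := eq_top_of_generators_mem hz hx hy ▸ Subgroup.mem_top h
  exact key k

theorem ofPure_injective : Function.Injective ofPure := by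
  intro h k hk
  simpa using (act_ofPure h 1).symm.trans ((congrArg (act · (0, 1)) hk).trans (act_ofPure k 1))

theorem range_ofPure {π : BraidGroup 3 →* Equiv.Perm (Fin 3)}
    (hπ : ∀ i, π (bβ i) = Equiv.swap (finL i) (finR i)) : ofPure.range = π.ker := by
  have h0 : π (bβ 0) = Equiv.swap 0 1 := hπ 0
  have h1 : π (bβ 1) = Equiv.swap 1 2 := hπ 1
  have hle : ofPure.range ≤ π.ker := by
    rintro _ ⟨⟨n, w⟩, rfl⟩
    have hz : π fullTwist = 1 := by
      rw [fullTwist, map_pow, _root_.map_mul, h0, h1]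
      decide
    have hw : π.comp (FreeGroup.lift ![bβ 0 * bβ 0, bβ 1 * bβ 1]) = 1 := by
      ext1 i
      fin_cases i <;> simp [h0, h1]
    have hw' := DFunLike.congr_fun hw w
    simp only [MonoidHom.comp_apply, MonoidHom.one_apply] at hw'
    simp [MonoidHom.mem_ker, ofPure, hz, hw']
  refine le_antisymm hle fun g hg => ?_
  have h := assemble_act g (0, 1)
  generalize act g (0, 1) = q at h
  obtain ⟨i, k⟩ := q
  simp only [assemble, cosetRep, Matrix.cons_val_zero, ofPure.map_one, mul_one] at h
  subst h
  have hk : π (ofPure k) = 1 := hle ⟨k, rfl⟩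
  rw [MonoidHom.mem_ker, _root_.map_mul, hk, mul_one] at hg
  fin_cases i <;> simp [h0, h1] at hg
  · exact ⟨k, (one_mul _).symm⟩
  all_goals exact absurd hg (by decide)

end BraidGroup

/-- `PB(3) ≅ ℤ × F₂`, with the `ℤ` factor corresponding to the subgroup
generated by the full twist `(β₁β₂)³`: the isomorphism can be chosen to send the full
twist to the generator `(1, 1)` of the factor `ℤ × {1}`. -/
theorem pureBraid3_iso (π : BraidGroup 3 →* Equiv.Perm (Fin 3))
    (hπ : ∀ i, π (bβ i) = Equiv.swap (finL i) (finR i)) :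
    ∃ (h : ((bβ 0 * bβ 1 : BraidGroup 3) ^ 3) ∈ MonoidHom.ker π)
      (e : ↥(MonoidHom.ker π) ≃* (Multiplicative ℤ × FreeGroup (Fin 2))),
      e ⟨(bβ 0 * bβ 1 : BraidGroup 3) ^ 3, h⟩ = (Multiplicative.ofAdd (1 : ℤ), 1) := by
  have hr := BraidGroup.range_ofPure hπ
  have hz : BraidGroup.fullTwist ∈ π.ker := hr ▸ ⟨PureModel.z, BraidGroup.ofPure_z⟩
  refine ⟨hz, ((MonoidHom.ofInjective BraidGroup.ofPure_injective).trans
    (MulEquiv.subgroupCongr hr)).symm, ?_⟩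
  rw [MulEquiv.symm_apply_eq]
  exact Subtype.ext BraidGroup.ofPure_z.symm
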